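/- Let X₁,…,Xₙ be i.i.d. from a probability measure P on [0,1]^d with density f with respect to Lebesgue measure μ, let 0 < γ, and let s_n be a monotone diverging sequence with j' = ⌊j + log₂ s_n⌋. For any 0 < δ < 1, with probability at least 1 − δ, the following holds simultaneously for all integers j ≥ 0: |V_{γ,j} − V̂_{γ,j}| ≤ Ψ_{j'}, where Ψ_{j'} is the penalty at resolution j' with confidence parameter δ. -/

import Mathlib

open MeasureTheory Filter

noncomputable section

abbrev Pt (d : ℕ) := EuclideanSpace ℝ (Fin d)

/-- The unit cube `[0,1]^d`. -/
def cube (d : ℕ) : Set (Pt d) := {x | ∀ i, 0 ≤ x i ∧ x i ≤ 1}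

/-- The closed `ε`-ball around `x`, relative to the cube `[0,1]^d`. -/
def ballC (d : ℕ) (x : Pt d) (ε : ℝ) : Set (Pt d) := {y ∈ cube d | dist y x ≤ ε}

/-- The inner `ε`-cover of `G`: the union of all `ε`-balls contained in `G`. -/
def innerCover (d : ℕ) (ε : ℝ) (G : Set (Pt d)) : Set (Pt d) :=
  ⋃ x ∈ {x : Pt d | ballC d x ε ⊆ G}, ballC d x ε

open Classical in
/-- The Hausdorff error `d_∞(G₁, G₂)`, defined as `√d` if either set is empty. -/
def hausd (d : ℕ) (G₁ G₂ : Set (Pt d)) : ℝ :=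
  if G₁.Nonempty ∧ G₂.Nonempty then
    max (⨆ x ∈ G₂, Metric.infDist x G₁) (⨆ x ∈ G₁, Metric.infDist x G₂)
  else Real.sqrt d

/-- Indices for the cells of the regular partition of `[0,1]^d` at resolution `j`. -/
abbrev CellIdx (d j : ℕ) := Fin d → Fin (2 ^ j)

/-- The dyadic hypercube cell of sidelength `2⁻ʲ` indexed by `k` (cells on the
upper boundary of the cube are closed on the right, so that the cells partition
`[0,1]^d`). -/
def cell (d j : ℕ) (k : CellIdx d j) : Set (Pt d) :=
  {x | ∀ i, ((k i : ℕ) : ℝ) / 2 ^ j ≤ x i ∧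
    (x i < (((k i : ℕ) : ℝ) + 1) / 2 ^ j ∨ ((k i : ℕ) + 1 = 2 ^ j ∧ x i ≤ 1))}

/-- Empirical probability of a set `A`. -/
def Phat {d n : ℕ} (ω : Fin n → Pt d) (A : Set (Pt d)) : ℝ :=
  (∑ i, A.indicator (fun _ => (1 : ℝ)) (ω i)) / n

/-- Empirical average density `f̂(A) = P̂(A)/μ(A)` of the cell indexed by `k`. -/
def fhat {d n : ℕ} (j : ℕ) (ω : Fin n → Pt d) (k : CellIdx d j) : ℝ :=
  Phat ω (cell d j k) * 2 ^ (j * d)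

/-- True average density `f̄(A) = P(A)/μ(A)` of the cell indexed by `k`. -/
def fbar {d : ℕ} (P : Measure (Pt d)) (j : ℕ) (k : CellIdx d j) : ℝ :=
  (P (cell d j k)).toReal * 2 ^ (j * d)

/-- The plug-in level set estimator at resolution `j`. -/
def Ghat (d n j : ℕ) (γ : ℝ) (ω : Fin n → Pt d) : Set (Pt d) :=
  ⋃ k ∈ {k : CellIdx d j | γ ≤ fhat j ω k}, cell d j k

/-- The `γ`-level set of `f` on `[0,1]^d`. -/
def Gstar (d : ℕ) (f : Pt d → ℝ) (γ : ℝ) : Set (Pt d) := {x ∈ cube d | γ ≤ f x}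

/-- The penalty `Ψ_j` at resolution `j` with confidence parameter `δ`. -/
def pen (d n j : ℕ) (δ : ℝ) (ω : Fin n → Pt d) : ℝ :=
  ⨆ k : CellIdx d j,
    Real.sqrt (8 * (Real.log ((2 : ℝ) ^ (j * (d + 1)) * 16 / δ) / ((n : ℝ) / 2 ^ (j * d))) *
      max (fhat j ω k)
        (8 * (Real.log ((2 : ℝ) ^ (j * (d + 1)) * 16 / δ) / ((n : ℝ) / 2 ^ (j * d)))))

/-- `j' = ⌊j + log₂ s⌋`. -/
def jprime (j : ℕ) (s : ℝ) : ℕ := (⌊(j : ℝ) + Real.logb 2 s⌋).toNat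

/-- Generic vernier: min over cells at resolution `j` of the max over subcells at
resolution `j'` of `|γ - g(A')|`. -/
def vernier (d : ℕ) (γ : ℝ) (j j' : ℕ) (g : CellIdx d j' → ℝ) : ℝ :=
  ⨅ k : CellIdx d j, ⨆ k' : {k' : CellIdx d j' // cell d j' k' ⊆ cell d j k}, |γ - g k'.1|

/-- The vernier `V_{γ,j}`. -/
def V (d : ℕ) (P : Measure (Pt d)) (γ : ℝ) (j j' : ℕ) : ℝ := vernier d γ j j' (fbar P j')

/-- The empirical vernier `V̂_{γ,j}`. -/
def Vhat (d n : ℕ) (ω : Fin n → Pt d) (γ : ℝ) (j j' : ℕ) : ℝ := vernier d γ j j' (fhat j' ω)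

/-- The joint distribution of `n` i.i.d. observations from `P`. -/
def Pn {d : ℕ} (P : Measure (Pt d)) (n : ℕ) : Measure (Fin n → Pt d) :=
  Measure.pi fun _ => P

/-- `f` is a probability density (w.r.t. Lebesgue measure) supported on the unit cube,
and `P` is the corresponding probability measure. -/
def IsDensity (d : ℕ) (f : Pt d → ℝ) (P : Measure (Pt d)) : Prop :=
  Measurable f ∧ (∀ x, 0 ≤ f x) ∧ (∀ x, x ∉ cube d → f x = 0) ∧
  P = volume.withDensity (fun x => ENNReal.ofReal (f x)) ∧ IsProbabilityMeasure P

/-- The density `f` is bounded by `fmax`. -/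
def BoundedBy (d : ℕ) (f : Pt d → ℝ) (fmax : ℝ) : Prop := ∀ x, f x ≤ fmax

/-- Assumption [A1]: local density regularity (lower bound). -/
def A1 (d : ℕ) (f : Pt d → ℝ) (γ C₁ δ₁ α : ℝ) : Prop :=
  ∀ x ∈ cube d, |f x - γ| ≤ δ₁ →
    C₁ * Metric.infDist x (frontier (Gstar d f γ)) ^ α ≤ |f x - γ|

/-- Assumption [A2]: local density regularity (upper bound near some boundary point). -/
def A2 (d : ℕ) (f : Pt d → ℝ) (γ C₂ δ₂ α : ℝ) : Prop :=
  ∃ x₀ ∈ frontier (Gstar d f γ), ∀ x ∈ ballC d x₀ δ₂,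
    |f x - γ| ≤ C₂ * Metric.infDist x (frontier (Gstar d f γ)) ^ α

/-- Assumption [B]: level set regularity. -/
def AB (d : ℕ) (G : Set (Pt d)) (C₃ ε₀ : ℝ) : Prop :=
  ∀ ε : ℝ, 0 < ε → ε ≤ ε₀ →
    (innerCover d ε G).Nonempty ∧
    ∀ x ∈ frontier G, Metric.infDist x (innerCover d ε G) ≤ C₃ * ε


theorem measurableSet_cell (d j : ℕ) (k : CellIdx d j) : MeasurableSet (cell d j k) := by
  have hx : ∀ i, Measurable fun x : Pt d => x i := fun i => by fun_prop
  simp only [cell, Set.ofPred_forall]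
  refine MeasurableSet.iInter fun i => ?_
  exact (measurableSet_le measurable_const (hx i)).inter
    ((measurableSet_lt (hx i) measurable_const).union
      ((MeasurableSet.const _).inter (measurableSet_le (hx i) measurable_const)))

theorem abs_iSup_sub_iSup_le {ι : Type*} [Finite ι] {a b : ι → ℝ} {c : ℝ} (hc : 0 ≤ c)
    (h : ∀ i, |a i - b i| ≤ c) : |(⨆ i, a i) - ⨆ i, b i| ≤ c := by
  rcases isEmpty_or_nonempty ι with _ | _
  · simpa using hc
  rw [abs_sub_le_iff, sub_le_iff_le_add, sub_le_iff_le_add]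
  constructor <;> refine ciSup_le fun i => ?_
  · linarith [(abs_sub_le_iff.1 (h i)).1, le_ciSup (Set.finite_range b).bddAbove i]
  · linarith [(abs_sub_le_iff.1 (h i)).2, le_ciSup (Set.finite_range a).bddAbove i]

theorem abs_iInf_sub_iInf_le {ι : Type*} [Finite ι] {a b : ι → ℝ} {c : ℝ} (hc : 0 ≤ c)
    (h : ∀ i, |a i - b i| ≤ c) : |(⨅ i, a i) - ⨅ i, b i| ≤ c := by
  rcases isEmpty_or_nonempty ι with _ | _
  · simpa using hc
  rw [abs_sub_le_iff, sub_le_comm, sub_le_comm (a := iInf b)]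
  constructor <;> refine le_ciInf fun i => ?_
  · linarith [(abs_sub_le_iff.1 (h i)).1, ciInf_le (Set.finite_range a).bddBelow i]
  · linarith [(abs_sub_le_iff.1 (h i)).2, ciInf_le (Set.finite_range b).bddBelow i]

theorem abs_vernier_sub_vernier_le {d j j' : ℕ} (γ : ℝ) {g h : CellIdx d j' → ℝ} {c : ℝ}
    (hc : 0 ≤ c) (hgh : ∀ k, |g k - h k| ≤ c) :
    |vernier d γ j j' g - vernier d γ j j' h| ≤ c := by
  refine abs_iInf_sub_iInf_le hc fun k => abs_iSup_sub_iSup_le hc fun k' => ?_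
  refine (abs_abs_sub_abs_le _ _).trans ?_
  rw [sub_sub_sub_cancel_left, abs_sub_comm]
  exact hgh _

/-- The moment generating function of a centered Bernoulli variable is sub-Gaussian near `0`. -/
theorem integral_exp_mul_indicator_sub_le {Ω : Type*} [MeasurableSpace Ω] (P : Measure Ω)
    [IsProbabilityMeasure P] {A : Set Ω} (hA : MeasurableSet A) {t : ℝ} (ht : |t| ≤ 1) :
    ∫ x, Real.exp (t * (A.indicator (fun _ => (1 : ℝ)) x - P.real A)) ∂P
      ≤ Real.exp (P.real A * t ^ 2) := by
  set p := P.real A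
  have hfun : ∀ x, Real.exp (t * (A.indicator (fun _ => (1 : ℝ)) x - p)) =
      Real.exp (-(t * p)) * (1 + A.indicator (fun _ => Real.exp t - 1) x) := by
    intro x
    by_cases hx : x ∈ A
    · simp only [hx, Set.indicator_of_mem, add_sub_cancel, ← Real.exp_add]
      ring_nf
    · simp [hx]
  simp_rw [hfun]
  rw [integral_const_mul, integral_add (integrable_const _)
    ((integrable_const _).indicator hA), integral_indicator_const _ hA]
  simp only [integral_const, probReal_univ, smul_eq_mul, one_mul]
  have h1 : 1 + p * (Real.exp t - 1) ≤ Real.exp (p * (Real.exp t - 1)) := by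
    linarith [Real.add_one_le_exp (p * (Real.exp t - 1))]
  have h2 : Real.exp t - 1 ≤ t + t ^ 2 := by
    linarith [(abs_le.1 (Real.abs_exp_sub_one_sub_id_le ht)).2]
  calc Real.exp (-(t * p)) * (1 + p * (Real.exp t - 1))
      ≤ Real.exp (-(t * p)) * Real.exp (p * (Real.exp t - 1)) := by gcongr
    _ = Real.exp (-(t * p) + p * (Real.exp t - 1)) := (Real.exp_add _ _).symm
    _ ≤ Real.exp (p * t ^ 2) := by
        have := mul_le_mul_of_nonneg_left h2 (measureReal_nonneg : 0 ≤ p)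
        gcongr
        linarith

theorem measureReal_pi_sum_ge_le {Ω : Type*} [MeasurableSpace Ω] (P : Measure Ω)
    [IsProbabilityMeasure P] (n : ℕ) {Y : Ω → ℝ} (hY : Integrable (fun x => Real.exp (Y x)) P)
    (a : ℝ) :
    (Measure.pi fun _ : Fin n => P).real {ω | a ≤ ∑ i, Y (ω i)} ≤
      Real.exp (-a) * (∫ x, Real.exp (Y x) ∂P) ^ n := by
  have hint : Integrable (fun ω : Fin n → Ω => ∏ i, Real.exp (Y (ω i)))
      (Measure.pi fun _ : Fin n => P) := Integrable.fintype_prod fun _ => hY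
  have hprod := integral_fintype_prod_eq_prod (μ := fun _ : Fin n => P)
    (fun _ x => Real.exp (Y x))
  rw [Finset.prod_const, Finset.card_univ, Fintype.card_fin] at hprod
  have h := ProbabilityTheory.measure_ge_le_exp_mul_mgf (μ := Measure.pi fun _ : Fin n => P)
    (X := fun ω => ∑ i, Y (ω i)) a zero_le_one (by simpa only [one_mul, Real.exp_sum] using hint)
  simpa only [ProbabilityTheory.mgf, neg_one_mul, one_mul, Real.exp_sum, hprod] using h

/-- Chernoff bound for either tail (according to the sign of `t`) of the centered empirical
frequency. -/
theorem measure_sum_indicator_sub_ge_le {Ω : Type*} [MeasurableSpace Ω] (P : Measure Ω)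
    [IsProbabilityMeasure P] {A : Set Ω} (hA : MeasurableSet A) (n : ℕ) {t : ℝ} (ht : |t| ≤ 1)
    (a : ℝ) :
    (Measure.pi fun _ : Fin n => P).real
        {ω | n * a ≤ t * ∑ i, (A.indicator (fun _ => (1 : ℝ)) (ω i) - P.real A)} ≤
      Real.exp (n * (P.real A * t ^ 2 - a)) := by
  have hint : Integrable (fun x =>
      Real.exp (t * (A.indicator (fun _ => (1 : ℝ)) x - P.real A))) P := by
    have hmeas : Measurable (A.indicator fun _ => (1 : ℝ)) := measurable_const.indicator hA
    refine Integrable.of_bound (C := Real.exp 1) (by fun_prop) (ae_of_all _ fun x => ?_)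
    rw [Real.norm_eq_abs, Real.abs_exp, Real.exp_le_exp]
    refine (le_abs_self _).trans ?_
    rw [abs_mul]
    refine mul_le_one₀ ht (abs_nonneg _) ?_
    have h0 : 0 ≤ P.real A := measureReal_nonneg
    have h1 : P.real A ≤ 1 := measureReal_le_one
    by_cases hx : x ∈ A <;> simp only [hx, Set.indicator_of_mem, not_false_eq_true,
      Set.indicator_of_notMem] <;> rw [abs_le] <;> constructor <;> linarith
  simp only [Finset.mul_sum]
  refine (measureReal_pi_sum_ge_le P n hint (n * a)).trans ?_
  rw [mul_sub, sub_eq_neg_add, Real.exp_add, Real.exp_nat_mul _ n]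
  gcongr
  exact integral_exp_mul_indicator_sub_le P hA ht

theorem measure_sq_frequency_sub_gt_le {Ω : Type*} [MeasurableSpace Ω] (P : Measure Ω)
    [IsProbabilityMeasure P] {A : Set Ω} (hA : MeasurableSet A) {n : ℕ} (hn : 1 ≤ n) {ε : ℝ}
    (hε : 0 < ε) :
    (Measure.pi fun _ : Fin n => P)
        {ω | 8 * ε * max ((∑ i, A.indicator (fun _ => (1 : ℝ)) (ω i)) / n) (8 * ε) <
          (P.real A - (∑ i, A.indicator (fun _ => (1 : ℝ)) (ω i)) / n) ^ 2} ≤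
      ENNReal.ofReal (2 * Real.exp (-(n * ε))) := by
  set p := P.real A
  have hp : 0 ≤ p := measureReal_nonneg
  have hn' : (0 : ℝ) < n := by exact_mod_cast hn
  set r := max (2 * √(ε * p)) (8 * ε)
  have hr : 8 * ε ≤ r := le_max_right _ _
  have hr2 : 4 * (ε * p) ≤ r ^ 2 := by
    have h := Real.sq_sqrt (mul_nonneg hε.le hp)
    have : 2 * √(ε * p) ≤ r := le_max_left _ _
    nlinarith [Real.sqrt_nonneg (ε * p)]
  -- the exponent `t` nearly minimizing the Chernoff bound
  obtain ⟨t, ht0, ht1, ht⟩ : ∃ t, 0 ≤ t ∧ t ≤ 1 ∧ p * t ^ 2 - t * r ≤ -ε := by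
    by_cases h : r ≤ 2 * p
    · have hp0 : 0 < p := by linarith
      refine ⟨r / (2 * p), by positivity, by rwa [div_le_one (by positivity)], ?_⟩
      have : p * (r / (2 * p)) ^ 2 - r / (2 * p) * r = -(r ^ 2 / (4 * p)) := by
        field_simp; ring
      rw [this, neg_le_neg_iff, le_div_iff₀ (by positivity)]
      linarith
    · exact ⟨1, zero_le_one, le_rfl, by linarith⟩
  have key : ∀ u, |u| ≤ 1 → u ^ 2 = t ^ 2 → (Measure.pi fun _ : Fin n => P)
      {ω | n * (t * r) ≤ u * ∑ i, (A.indicator (fun _ => (1 : ℝ)) (ω i) - p)} ≤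
        ENNReal.ofReal (Real.exp (-(n * ε))) := by
    intro u hu hut
    rw [← ofReal_measureReal]
    refine ENNReal.ofReal_le_ofReal
      ((measure_sum_indicator_sub_ge_le P hA n hu _).trans (Real.exp_le_exp.2 ?_))
    rw [hut, ← mul_neg]
    gcongr
  have hadd := add_le_add (key t (by rwa [abs_of_nonneg ht0]) rfl)
    (key (-t) (by rwa [abs_neg, abs_of_nonneg ht0]) (neg_sq t))
  rw [← ENNReal.ofReal_add (Real.exp_pos _).le (Real.exp_pos _).le, ← two_mul] at hadd
  refine (measure_mono fun ω hω => ?_).trans ((measure_union_le _ _).trans hadd)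
  simp only [Set.mem_ofPred_eq, Set.mem_union] at hω ⊢
  set q := (∑ i, A.indicator (fun _ => (1 : ℝ)) (ω i)) / n with hq
  have hsum : ∑ i, (A.indicator (fun _ => (1 : ℝ)) (ω i) - p) = n * (q - p) := by
    rw [Finset.sum_sub_distrib, hq]
    simp
    field_simp
  have hrle : r ≤ |q - p| := by
    have h1 : 8 * ε * q < |q - p| ^ 2 := by
      rw [sq_abs, sub_sq_comm]
      exact (mul_le_mul_of_nonneg_left (le_max_left _ _) (by positivity)).trans_lt hω
    have h2 : (8 * ε) ^ 2 < |q - p| ^ 2 := by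
      rw [sq_abs, sub_sq_comm, pow_two (8 * ε)]
      exact (mul_le_mul_of_nonneg_left (le_max_right _ _) (by positivity)).trans_lt hω
    have h3 : 8 * ε < |q - p| := lt_of_pow_lt_pow_left₀ 2 (abs_nonneg _) h2
    refine max_le ?_ h3.le
    have h4 : p ≤ q + |q - p| := by linarith [neg_abs_le (q - p)]
    have h5 : ε * p ≤ (|q - p| / 2) ^ 2 := by
      nlinarith [mul_le_mul_of_nonneg_left h4 hε.le]
    linarith [(Real.sqrt_le_left (by positivity)).2 h5]
  have hr' := mul_le_mul_of_nonneg_left hrle (mul_nonneg hn'.le ht0)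
  rw [hsum]
  rcases abs_choice (q - p) with h | h <;> rw [h] at hr'
  · left; linarith
  · right; linarith

/-- The average densities over all cells of all resolutions deviate from their empirical
counterparts by at most the penalty, outside of an event of probability at most `δ`. -/
theorem measure_exists_pen_lt_le {d n : ℕ} (hn : 1 ≤ n) (P : Measure (Pt d))
    [IsProbabilityMeasure P] {δ : ℝ} (hδ0 : 0 < δ) (hδ1 : δ < 1) :
    Pn P n {ω | ∃ (m : ℕ) (k : CellIdx d m), pen d n m δ ω < |fbar P m k - fhat m ω k|} ≤
      ENNReal.ofReal δ := by
  have hn' : (0 : ℝ) < n := by exact_mod_cast hn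
  set L : ℕ → ℝ := fun m => Real.log ((2 : ℝ) ^ (m * (d + 1)) * 16 / δ) with hL
  have hLpos : ∀ m, 0 < L m := fun m => by
    refine Real.log_pos ?_
    rw [one_lt_div hδ0]
    have : (1 : ℝ) ≤ 2 ^ (m * (d + 1)) := one_le_pow₀ one_le_two
    linarith
  have hexp : ∀ m, Real.exp (-(n * (L m / n))) = δ / (2 ^ (m * (d + 1)) * 16) := fun m => by
    rw [mul_div_cancel₀ _ hn'.ne', Real.exp_neg, hL, Real.exp_log (by positivity), inv_div]
  have hcell : ∀ m (k : CellIdx d m), Pn P n {ω | pen d n m δ ω < |fbar P m k - fhat m ω k|} ≤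
      ENNReal.ofReal (2 * (δ / (2 ^ (m * (d + 1)) * 16))) := by
    intro m k
    rw [← hexp m]
    refine (measure_mono fun ω hω => ?_).trans (measure_sq_frequency_sub_gt_le P
      (measurableSet_cell d m k) hn (div_pos (hLpos m) hn'))
    simp only [Set.mem_ofPred_eq] at hω ⊢
    have hlt := (le_ciSup (f := fun k : CellIdx d m => √(8 * (L m / ((n : ℝ) / 2 ^ (m * d))) *
      max (fhat m ω k) (8 * (L m / ((n : ℝ) / 2 ^ (m * d)))))) (Set.finite_range _).bddAbove
      k).trans_lt hω
    rw [Real.sqrt_lt' ((Real.sqrt_nonneg _).trans_lt hlt), sq_abs] at hlt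
    have hB : (0 : ℝ) < 2 ^ (m * d) := by positivity
    set B : ℝ := 2 ^ (m * d) with hBdef
    have hscale : 8 * (L m / (n / B)) = 8 * (L m / n) * B := by field_simp
    rw [hscale] at hlt
    simp only [fbar, fhat, Phat, ← hBdef] at hlt
    rw [← max_mul_of_nonneg _ _ hB.le, ← sub_mul, mul_pow, mul_mul_mul_comm, ← pow_two B] at hlt
    exact lt_of_mul_lt_mul_right hlt (by positivity)
  have hres : ∀ m, Pn P n (⋃ k : CellIdx d m, {ω | pen d n m δ ω < |fbar P m k - fhat m ω k|}) ≤
      ENNReal.ofReal (δ / 8 * (1 / 2) ^ m) := by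
    intro m
    refine (measure_iUnion_le _).trans ((ENNReal.tsum_le_tsum (hcell m)).trans_eq ?_)
    rw [tsum_fintype, Finset.sum_const, ← ENNReal.ofReal_nsmul]
    congr 1
    simp only [Finset.card_univ, Fintype.card_pi, Fintype.card_fin, Finset.prod_const,
      nsmul_eq_mul]
    push_cast
    rw [mul_add, mul_one, pow_add, ← pow_mul, one_div, inv_pow]
    field_simp
    norm_num
  simp only [Set.ofPred_exists]
  refine (measure_iUnion_le _).trans ((ENNReal.tsum_le_tsum hres).trans ?_)
  rw [← ENNReal.ofReal_tsum_of_nonneg (fun m => by positivity)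
    (summable_geometric_two.mul_left _), tsum_mul_left, tsum_geometric_two]
  exact ENNReal.ofReal_le_ofReal (by linarith)

/-- **Corollary B.1**: with probability at least `1 - δ`, simultaneously for all `j ≥ 0`,
`|V_{γ,j} - V̂_{γ,j}| ≤ Ψ_{j'}`. -/
theorem statement11 (d n : ℕ) (hd : 1 ≤ d) (hn : 1 ≤ n)
    (f : Pt d → ℝ) (P : Measure (Pt d)) (hf : IsDensity d f P)
    (γ : ℝ) (hγ : 0 < γ)
    (s : ℕ → ℝ) (hmono : Monotone s) (hdiv : Tendsto s atTop atTop) (hpos : ∀ m, 0 < s m)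
    (δ : ℝ) (hδ0 : 0 < δ) (hδ1 : δ < 1) :
    ENNReal.ofReal (1 - δ) ≤ Pn P n {ω | ∀ j : ℕ,
      |V d P γ j (jprime j (s n)) - Vhat d n ω γ j (jprime j (s n))| ≤
        pen d n (jprime j (s n)) δ ω} := by
  have := hf.2.2.2.2
  have : IsProbabilityMeasure (Pn P n) := by unfold Pn; infer_instance
  refine (ENNReal.ofReal_sub _ hδ0.le).trans_le ?_
  rw [ENNReal.ofReal_one, tsub_le_iff_right, ← measure_univ (μ := Pn P n)]
  refine (measure_univ_le_add_compl _).trans (add_le_add_right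
    ((measure_mono fun ω hω => ?_).trans (measure_exists_pen_lt_le hn P hδ0 hδ1)) _)
  by_contra h
  refine hω fun j => ?_
  simp only [Set.mem_ofPred_eq, not_exists, not_lt] at h
  exact abs_vernier_sub_vernier_le γ (Real.iSup_nonneg fun _ => Real.sqrt_nonneg _) (h _)

end
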